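/- Every 2-random Turing degree forms a minimal pair with every 2-generic Turing degree. -/

import Mathlib

/-
Common framework: oracle (relative) partial computability via codes,
Turing reducibility, the jump, Cantor-space measure, Martin-Löf randomness
and genericity relative to an oracle, Turing functionals.
-/

open scoped ENNReal

namespace TypicalDegree

/-- Codes for partial functions recursive in an oracle (Kleene-style),
    following `Nat.Partrec.Code` with an extra `oracle` constructor. -/
inductive OracleCode : Type
  | zero : OracleCode
  | succ : OracleCode
  | left : OracleCode
  | right : OracleCode
  | oracle : OracleCode
  | pair : OracleCode → OracleCode → OracleCode
  | comp : OracleCode → OracleCode → OracleCode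
  | prec : OracleCode → OracleCode → OracleCode
  | rfind' : OracleCode → OracleCode

/-- Evaluation of an oracle code relative to an oracle `g : ℕ →. ℕ`. -/
def OracleCode.eval (g : ℕ →. ℕ) : OracleCode → ℕ →. ℕ
  | .zero => pure 0
  | .succ => Nat.succ
  | .left => ↑fun n : ℕ => n.unpair.1
  | .right => ↑fun n : ℕ => n.unpair.2
  | .oracle => g
  | .pair cf cg => fun n => Nat.pair <$> OracleCode.eval g cf n <*> OracleCode.eval g cg n
  | .comp cf cg => fun n => OracleCode.eval g cg n >>= OracleCode.eval g cf
  | .prec cf cg =>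
    Nat.unpaired fun a n =>
      n.rec (OracleCode.eval g cf a) fun y IH => do
        let i ← IH
        OracleCode.eval g cg (Nat.pair a (Nat.pair y i))
  | .rfind' cf =>
    Nat.unpaired fun a m =>
      (Nat.rfind fun n => (fun m => m = 0) <$> OracleCode.eval g cf (Nat.pair a (n + m))).map
        (· + m)

/-- An effective injective numbering of oracle codes. -/
def OracleCode.encodeCode : OracleCode → ℕ
  | .zero => 0
  | .succ => 1
  | .left => 2
  | .right => 3
  | .oracle => 4
  | .pair cf cg => 4 * Nat.pair cf.encodeCode cg.encodeCode + 5
  | .comp cf cg => 4 * Nat.pair cf.encodeCode cg.encodeCode + 6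
  | .prec cf cg => 4 * Nat.pair cf.encodeCode cg.encodeCode + 7
  | .rfind' cf => 4 * Nat.pair cf.encodeCode cf.encodeCode + 8

/-- The characteristic (total) oracle of an element of Cantor space. -/
def chi (X : ℕ → Bool) : ℕ →. ℕ := fun n => Part.some (cond (X n) 1 0)

/-- `f` is partial recursive relative to the oracle `g`. -/
def RedIn (f g : ℕ →. ℕ) : Prop := ∃ c : OracleCode, c.eval g = f

/-- A total function `ℕ → ℕ` viewed as a partial function. -/
def natFun (f : ℕ → ℕ) : ℕ →. ℕ := fun n => Part.some (f n)

/-- Turing reducibility between elements of Cantor space. -/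
def TRed (X Y : ℕ → Bool) : Prop := RedIn (chi X) (chi Y)

/-- Turing equivalence. -/
def TEquiv (X Y : ℕ → Bool) : Prop := TRed X Y ∧ TRed Y X

/-- `X` is computable. -/
def ComputableSeq (X : ℕ → Bool) : Prop := TRed X fun _ => false

/-- `f : ℕ → ℕ` is computable. -/
def ComputableFun (f : ℕ → ℕ) : Prop := RedIn (natFun f) (chi fun _ => false)

/-- The Turing jump of `X`: the halting problem relative to `X`,
    under the numbering `encodeCode`. -/
noncomputable def jump (X : ℕ → Bool) : ℕ → Bool := fun n =>
  @decide (∃ c : OracleCode, c.encodeCode = n ∧ (c.eval (chi X) n).Dom) (Classical.dec _)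

/-- `∅'`, the halting problem. -/
noncomputable def zeroJump : ℕ → Bool := jump fun _ => false

/-- `X` extends the finite binary string `σ` (i.e. `σ ⊂ X`). -/
def extendsStr (X : ℕ → Bool) (σ : List Bool) : Prop :=
  ∀ i : Fin σ.length, X i.1 = σ.get i

/-- `⟦V⟧`: the open set of infinite sequences extending some string in `V`. -/
def openOf (V : Set (List Bool)) : Set (ℕ → Bool) := {X | ∃ σ ∈ V, extendsStr X σ}

/-- The (fair-coin) measure of the open set `⟦V⟧` determined by a set of strings `V`:
    the supremum over `n` of the proportion of length-`n` strings with a prefix in `V`. -/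
noncomputable def stringMeasure (V : Set (List Bool)) : ℝ≥0∞ :=
  ⨆ n : ℕ, (Nat.card {f : Fin n → Bool // ∃ σ ∈ V, σ <+: List.ofFn f} : ℝ≥0∞) / 2 ^ n

/-- The fair-coin (Lebesgue) measure on Cantor space, as the outer measure obtained from
    open coverings by sets of strings; it agrees with Lebesgue measure on measurable sets. -/
noncomputable def cantorMeasure (S : Set (ℕ → Bool)) : ℝ≥0∞ :=
  ⨅ (V : Set (List Bool)) (_ : S ⊆ openOf V), stringMeasure V

/-- `W` is computably enumerable relative to `X`. -/
def CEIn (X : ℕ → Bool) (W : Set (List Bool)) : Prop :=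
  ∃ c : OracleCode, ∀ σ : List Bool, σ ∈ W ↔ (c.eval (chi X) (Encodable.encode σ)).Dom

/-- `W` is computably enumerable. -/
def CE (W : Set (List Bool)) : Prop := CEIn (fun _ => false) W

/-- The c.e. set of strings with index `d`. -/
def ceSetOf (d : OracleCode) : Set (List Bool) :=
  {σ | (d.eval (chi fun _ => false) (Encodable.encode σ)).Dom}

/-- The sequence `V` of sets of strings is uniformly c.e. relative to `X`. -/
def UniformCEIn (X : ℕ → Bool) (V : ℕ → Set (List Bool)) : Prop :=
  ∃ c : OracleCode, ∀ (i : ℕ) (σ : List Bool),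
    σ ∈ V i ↔ (c.eval (chi X) (Nat.pair i (Encodable.encode σ))).Dom

/-- A Martin-Löf test relative to `X`. -/
def MLTest (X : ℕ → Bool) (V : ℕ → Set (List Bool)) : Prop :=
  UniformCEIn X V ∧ ∀ i : ℕ, stringMeasure (V i) < (2 : ℝ≥0∞)⁻¹ ^ i

/-- `Y` is Martin-Löf random relative to `X`. -/
def MLRandomIn (X Y : ℕ → Bool) : Prop :=
  ∀ V : ℕ → Set (List Bool), MLTest X V → ∃ i, Y ∉ openOf (V i)

/-- `Y` is 1-random. -/
def OneRandom (Y : ℕ → Bool) : Prop := MLRandomIn (fun _ => false) Y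

/-- `Y` is 2-random: Martin-Löf random relative to `∅'`. -/
def TwoRandom (Y : ℕ → Bool) : Prop := MLRandomIn zeroJump Y

/-- `Y` is weakly 2-random: it avoids every null `Π⁰₂` class
    (every null intersection of a uniformly c.e. sequence of open sets). -/
def Weak2Random (Y : ℕ → Bool) : Prop :=
  ∀ V : ℕ → Set (List Bool), UniformCEIn (fun _ => false) V →
    cantorMeasure (⋂ i, openOf (V i)) = 0 → Y ∉ ⋂ i, openOf (V i)

/-- `Y` is 1-generic relative to `X`. -/
def OneGenericIn (X Y : ℕ → Bool) : Prop :=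
  ∀ W : Set (List Bool), CEIn X W →
    ∃ σ : List Bool, extendsStr Y σ ∧ (σ ∈ W ∨ ∀ τ : List Bool, σ <+: τ → τ ∉ W)

/-- `Y` is 1-generic. -/
def OneGeneric (Y : ℕ → Bool) : Prop := OneGenericIn (fun _ => false) Y

/-- `Y` is 2-generic: 1-generic relative to `∅'`. -/
def TwoGeneric (Y : ℕ → Bool) : Prop := OneGenericIn zeroJump Y

/-- The Turing functional coded by `c` is total on oracle `X` with value `Y ∈ 2^ω`
    (i.e. `Ψ^X = Y`). -/
def FTotal (c : OracleCode) (X : ℕ → Bool) (Y : ℕ → Bool) : Prop :=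
  c.eval (chi X) = chi Y

/-- `Ψ^X ⊇ σ`: the output of the functional `c` on oracle `X` extends the string `σ`. -/
def FExtends (c : OracleCode) (X : ℕ → Bool) (σ : List Bool) : Prop :=
  ∀ i : Fin σ.length, c.eval (chi X) i.1 = Part.some (cond (σ.get i) 1 0)

/-- `π(Ψ,σ) = μ({X : Ψ^X ⊇ σ})`. -/
noncomputable def piMeasure (c : OracleCode) (σ : List Bool) : ℝ≥0∞ :=
  cantorMeasure {X | FExtends c X σ}

/-- A Turing functional is special if every infinite binary sequence
    in its range is incomputable. -/
def Special (c : OracleCode) : Prop :=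
  ∀ X Y : ℕ → Bool, FTotal c X Y → ¬ ComputableSeq Y

/-- The code `c` computes the total function `T` on strings (no oracle). -/
def ComputesFun (c : OracleCode) (T : List Bool → Bool) : Prop :=
  ∀ σ : List Bool, c.eval (chi fun _ => false) (Encodable.encode σ) = Part.some (cond (T σ) 1 0)

/-- `T` is (the characteristic function of) a tree: closed under prefixes. -/
def IsTree (T : List Bool → Bool) : Prop :=
  ∀ σ τ : List Bool, σ <+: τ → T τ = true → T σ = true

/-- The set of infinite paths through the tree `T`; `Π⁰₁` classes are the
    sets of paths through computable trees. -/
def pathsOf (T : List Bool → Bool) : Set (ℕ → Bool) :=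
  {X | ∀ n : ℕ, T (List.ofFn fun i : Fin n => X i.1) = true}

/-- The computable join `X ⊕ Y`. -/
def join (X Y : ℕ → Bool) : ℕ → Bool := fun n =>
  if n % 2 = 0 then X (n / 2) else Y (n / 2)

/-- A finite string used as a (partial) oracle. -/
def strOracle (τ : List Bool) : ℕ →. ℕ := fun n =>
  if h : n < τ.length then Part.some (cond (τ.get ⟨n, h⟩) 1 0) else Part.none

/-- `Ψ^{τ₀}` and `Ψ^{τ₁}` are incompatible: they give different outputs somewhere. -/
def SplitPair (c : OracleCode) (τ₀ τ₁ : List Bool) : Prop :=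
  ∃ (n v₀ v₁ : ℕ), v₀ ∈ c.eval (strOracle τ₀) n ∧ v₁ ∈ c.eval (strOracle τ₁) n ∧ v₀ ≠ v₁

/-- `(U,V)` is a `Ψ`-splitting above `τ`. -/
def SplittingAbove (c : OracleCode) (τ : List Bool) (U V : Finset (List Bool)) : Prop :=
  (∃ ℓ : ℕ, ∀ σ ∈ U ∪ V, σ.length = ℓ ∧ τ <+: σ) ∧
    ∀ σ₀ ∈ U, ∀ σ₁ ∈ V, SplitPair c σ₀ σ₁

/-- The output sequence `Ψ^X` of the functional `c` on oracle `X`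
    (defaults to `false` when not total). -/
noncomputable def outSeq (c : OracleCode) (X : ℕ → Bool) : ℕ → Bool := fun n =>
  @dite _ (∃ Y : ℕ → Bool, FTotal c X Y) (Classical.dec _) (fun h => h.choose n) fun _ => false

/-- `Ψ^X ↾ n`, as a finite string. -/
noncomputable def outStr (c : OracleCode) (X : ℕ → Bool) (n : ℕ) : List Bool :=
  List.ofFn fun i : Fin n => outSeq c X i.1

/-- The degree of `M` is a minimal Turing degree. -/
def MinimalDeg (M : ℕ → Bool) : Prop :=
  ¬ ComputableSeq M ∧ ∀ Z : ℕ → Bool, TRed Z M → ComputableSeq Z ∨ TRed M Z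


namespace OracleCode

theorem mem_pair {g : ℕ →. ℕ} {cf cg : OracleCode} {n v : ℕ} :
    v ∈ (OracleCode.pair cf cg).eval g n ↔
      ∃ a ∈ cf.eval g n, ∃ b ∈ cg.eval g n, v = Nat.pair a b := by
  simp [OracleCode.eval, Seq.seq, eq_comm]

theorem mem_comp {g : ℕ →. ℕ} {cf cg : OracleCode} {n v : ℕ} :
    v ∈ (OracleCode.comp cf cg).eval g n ↔ ∃ a ∈ cg.eval g n, v ∈ cf.eval g a :=
  Part.mem_bind_iff

theorem eval_prec_zero {g : ℕ →. ℕ} {cf cg : OracleCode} {a : ℕ} :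
    (OracleCode.prec cf cg).eval g (Nat.pair a 0) = cf.eval g a := by
  simp [OracleCode.eval]

theorem mem_prec_succ {g : ℕ →. ℕ} {cf cg : OracleCode} {a k v : ℕ} :
    v ∈ (OracleCode.prec cf cg).eval g (Nat.pair a (k + 1)) ↔
      ∃ i ∈ (OracleCode.prec cf cg).eval g (Nat.pair a k),
        v ∈ cg.eval g (Nat.pair a (Nat.pair k i)) := by
  simp [OracleCode.eval]

theorem mem_rfind' {g : ℕ →. ℕ} {cf : OracleCode} {a m v : ℕ} :
    v ∈ (OracleCode.rfind' cf).eval g (Nat.pair a m) ↔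
      ∃ k, v = k + m ∧ 0 ∈ cf.eval g (Nat.pair a (k + m)) ∧
        ∀ j < k, ∃ y, y ≠ 0 ∧ y ∈ cf.eval g (Nat.pair a (j + m)) := by
  simp only [OracleCode.eval, Nat.unpaired, Nat.unpair_pair, Part.mem_map_iff]
  constructor
  · rintro ⟨k, h, rfl⟩
    obtain ⟨h1, h2⟩ := Nat.mem_rfind.1 h
    refine ⟨k, rfl, ?_, fun j hj => ?_⟩
    · simpa using h1
    · have := h2 hj
      simp at this
      obtain ⟨y, hy, h⟩ := this
      exact ⟨y, h, hy⟩
  · rintro ⟨k, rfl, h1, h2⟩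
    refine ⟨k, Nat.mem_rfind.2 ⟨?_, fun {j} hj => ?_⟩, rfl⟩
    · simpa using h1
    · obtain ⟨y, h, hy⟩ := h2 j hj
      simp
      exact ⟨y, hy, h⟩

theorem eval_mono {g g' : ℕ →. ℕ} (h : ∀ n v, v ∈ g n → v ∈ g' n) (c : OracleCode) :
    ∀ n v, v ∈ c.eval g n → v ∈ c.eval g' n := by
  induction c with
  | zero => exact fun n v hv => hv
  | succ => exact fun n v hv => hv
  | left => exact fun n v hv => hv
  | right => exact fun n v hv => hv
  | oracle => exact h
  | pair cf cg hf hg =>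
    intro n v
    rw [mem_pair, mem_pair]
    rintro ⟨a, ha, b, hb, rfl⟩
    exact ⟨a, hf _ _ ha, b, hg _ _ hb, rfl⟩
  | comp cf cg hf hg =>
    intro n v
    rw [mem_comp, mem_comp]
    rintro ⟨a, ha, hb⟩
    exact ⟨a, hg _ _ ha, hf _ _ hb⟩
  | prec cf cg hf hg =>
    intro n
    obtain ⟨⟨a, k⟩, rfl⟩ : ∃ p : ℕ × ℕ, n = Nat.pair p.1 p.2 := ⟨n.unpair, by simp⟩
    dsimp only
    induction k with
    | zero => intro v; rw [eval_prec_zero, eval_prec_zero]; exact hf _ _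
    | succ k ih =>
      intro v
      rw [mem_prec_succ, mem_prec_succ]
      rintro ⟨i, hi, hv⟩
      exact ⟨i, ih _ hi, hg _ _ hv⟩
  | rfind' cf hf =>
    intro n v
    obtain ⟨⟨a, m⟩, rfl⟩ : ∃ p : ℕ × ℕ, n = Nat.pair p.1 p.2 := ⟨n.unpair, by simp⟩
    dsimp only
    rw [mem_rfind', mem_rfind']
    rintro ⟨k, rfl, h0, h1⟩
    refine ⟨k, rfl, hf _ _ h0, fun j hj => ?_⟩
    obtain ⟨y, hy, hy'⟩ := h1 j hj
    exact ⟨y, hy, hf _ _ hy'⟩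

end OracleCode

/-- The initial segment of `X` of length `m`. -/
def pre (X : ℕ → Bool) (m : ℕ) : List Bool := List.ofFn fun i : Fin m => X i

@[simp] theorem length_pre (X : ℕ → Bool) (m : ℕ) : (pre X m).length = m := by simp [pre]

theorem pre_getElem? (X : ℕ → Bool) (m n : ℕ) :
    (pre X m)[n]? = if n < m then some (X n) else none := by
  by_cases h : n < m <;> simp [pre, h]

theorem extendsStr_iff {X : ℕ → Bool} {σ : List Bool} : extendsStr X σ ↔ σ = pre X σ.length := by
  constructor
  · intro h
    apply List.ext_getElem (by simp)
    intro i h1 h2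
    have := h ⟨i, h1⟩
    simp [pre] at this ⊢
    exact this.symm
  · intro h i
    have : σ[i.1]? = (pre X σ.length)[i.1]? := by rw [← h]
    rw [pre_getElem?] at this
    simp at this
    simpa using this.symm

theorem extendsStr_pre (X : ℕ → Bool) (m : ℕ) : extendsStr X (pre X m) := by
  rw [extendsStr_iff]; simp

theorem pre_mono (X : ℕ → Bool) {m m' : ℕ} (h : m ≤ m') : pre X m <+: pre X m' := by
  rw [List.prefix_iff_getElem?]
  intro i hi
  rw [length_pre] at hi
  rw [pre_getElem?, if_pos (by omega)]
  simp [pre]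

theorem mem_strOracle {τ : List Bool} {n v : ℕ} :
    v ∈ strOracle τ n ↔ ∃ b, τ[n]? = some b ∧ v = cond b 1 0 := by
  unfold strOracle
  split_ifs with h
  · simp [h]
  · simp [h]

theorem strOracle_mono {σ τ : List Bool} (h : σ <+: τ) (n v : ℕ) (hv : v ∈ strOracle σ n) :
    v ∈ strOracle τ n := by
  rw [mem_strOracle] at *
  obtain ⟨b, hb, rfl⟩ := hv
  refine ⟨b, ?_, rfl⟩
  obtain ⟨η, rfl⟩ := h
  have := (List.getElem?_eq_some_iff.1 hb).1
  rw [List.getElem?_append_left this, hb]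

theorem eval_str_mono {c : OracleCode} {σ τ : List Bool} (h : σ <+: τ) {n v : ℕ}
    (hv : v ∈ c.eval (strOracle σ) n) : v ∈ c.eval (strOracle τ) n :=
  OracleCode.eval_mono (strOracle_mono h) c n v hv

theorem eval_chi_of_str {c : OracleCode} {X : ℕ → Bool} {m n v : ℕ}
    (hv : v ∈ c.eval (strOracle (pre X m)) n) : v ∈ c.eval (chi X) n := by
  refine OracleCode.eval_mono (fun n v hv => ?_) c n v hv
  rw [mem_strOracle] at hv
  obtain ⟨b, hb, rfl⟩ := hv
  rw [pre_getElem?] at hb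
  split_ifs at hb
  simp at hb
  simp [chi, hb]

theorem bounded_choice {P : ℕ → ℕ → Prop} (hP : ∀ j m m', m ≤ m' → P j m → P j m') (k : ℕ)
    (h : ∀ j < k, ∃ m, P j m) : ∃ M, ∀ j < k, P j M := by
  induction k with
  | zero => exact ⟨0, by simp⟩
  | succ k ih =>
    obtain ⟨M, hM⟩ := ih fun j hj => h j (by omega)
    obtain ⟨m, hm⟩ := h k (by omega)
    refine ⟨max M m, fun j hj => ?_⟩
    rcases Nat.lt_succ_iff_lt_or_eq.1 hj with hj | rfl
    · exact hP _ _ _ (le_max_left _ _) (hM j hj)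
    · exact hP _ _ _ (le_max_right _ _) hm

theorem eval_use {X : ℕ → Bool} (c : OracleCode) : ∀ n v, v ∈ c.eval (chi X) n →
    ∃ m, v ∈ c.eval (strOracle (pre X m)) n := by
  have mono : ∀ {c : OracleCode} {m m' n v : ℕ}, m ≤ m' →
      v ∈ c.eval (strOracle (pre X m)) n → v ∈ c.eval (strOracle (pre X m')) n :=
    fun h hv => eval_str_mono (pre_mono X h) hv
  induction c with
  | zero => exact fun n v hv => ⟨0, hv⟩
  | succ => exact fun n v hv => ⟨0, hv⟩
  | left => exact fun n v hv => ⟨0, hv⟩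
  | right => exact fun n v hv => ⟨0, hv⟩
  | oracle =>
    intro n v hv
    refine ⟨n + 1, ?_⟩
    change v ∈ strOracle _ n
    rw [mem_strOracle]
    refine ⟨X n, by rw [pre_getElem?, if_pos (Nat.lt_succ_self n)], ?_⟩
    simpa [OracleCode.eval, chi] using hv
  | pair cf cg hf hg =>
    intro n v
    simp only [OracleCode.mem_pair]
    rintro ⟨a, ha, b, hb, rfl⟩
    obtain ⟨m1, h1⟩ := hf _ _ ha
    obtain ⟨m2, h2⟩ := hg _ _ hb
    exact ⟨max m1 m2, a, mono (le_max_left _ _) h1, b, mono (le_max_right _ _) h2, rfl⟩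
  | comp cf cg hf hg =>
    intro n v
    simp only [OracleCode.mem_comp]
    rintro ⟨a, ha, hb⟩
    obtain ⟨m1, h1⟩ := hg _ _ ha
    obtain ⟨m2, h2⟩ := hf _ _ hb
    exact ⟨max m1 m2, a, mono (le_max_left _ _) h1, mono (le_max_right _ _) h2⟩
  | prec cf cg hf hg =>
    intro n
    obtain ⟨⟨a, k⟩, rfl⟩ : ∃ p : ℕ × ℕ, n = Nat.pair p.1 p.2 := ⟨n.unpair, by simp⟩
    dsimp only
    induction k with
    | zero => intro v; simp only [OracleCode.eval_prec_zero]; exact hf _ _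
    | succ k ih =>
      intro v
      simp only [OracleCode.mem_prec_succ]
      rintro ⟨i, hi, hv⟩
      obtain ⟨m1, h1⟩ := ih _ hi
      obtain ⟨m2, h2⟩ := hg _ _ hv
      exact ⟨max m1 m2, i, mono (le_max_left _ _) h1, mono (le_max_right _ _) h2⟩
  | rfind' cf hf =>
    intro n v
    obtain ⟨⟨a, m⟩, rfl⟩ : ∃ p : ℕ × ℕ, n = Nat.pair p.1 p.2 := ⟨n.unpair, by simp⟩
    dsimp only
    simp only [OracleCode.mem_rfind']
    rintro ⟨k, rfl, h0, h1⟩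
    obtain ⟨m0, h0⟩ := hf _ _ h0
    obtain ⟨M, hM⟩ := bounded_choice (k := k)
      (P := fun j M => ∃ y, y ≠ 0 ∧ y ∈ cf.eval (strOracle (pre X M)) (Nat.pair a (j + m)))
      (fun j m m' h => fun ⟨y, hy, hy'⟩ => ⟨y, hy, mono h hy'⟩) (fun j hj => by
        obtain ⟨y, hy, hy'⟩ := h1 j hj
        obtain ⟨m, hm⟩ := hf _ _ hy'
        exact ⟨m, y, hy, hm⟩)
    refine ⟨max m0 M, k, rfl, mono (le_max_left _ _) h0, fun j hj => ?_⟩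
    obtain ⟨y, hy, hy'⟩ := hM j hj
    exact ⟨y, hy, mono (le_max_right _ _) hy'⟩

theorem partrec_rfind_param {α : Type} [Primcodable α] {F : α → ℕ →. ℕ} (hF : Partrec₂ F) :
    Partrec fun p : α × ℕ => (Nat.rfind fun n => (F p.1 (Nat.pair p.2.unpair.1
      (n + p.2.unpair.2))).map fun m => decide (m = 0)).map (· + p.2.unpair.2) := by
  have hadd : Primrec fun q : (α × ℕ) × ℕ => q.2 + q.1.2.unpair.2 :=
    Primrec.nat_add.comp Primrec.snd
      (Primrec.snd.comp (Primrec.unpair.comp (Primrec.snd.comp Primrec.fst)))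
  have hpr : Primrec fun q : (α × ℕ) × ℕ =>
      Nat.pair q.1.2.unpair.1 (q.2 + q.1.2.unpair.2) :=
    Primrec₂.natPair.comp (Primrec.fst.comp (Primrec.unpair.comp
      (Primrec.snd.comp Primrec.fst))) hadd
  have hq : Partrec fun (q : (α × ℕ) × ℕ) =>
      F q.1.1 (Nat.pair q.1.2.unpair.1 (q.2 + q.1.2.unpair.2)) :=
    Partrec₂.comp hF (Computable.fst.comp Computable.fst) hpr.to_comp
  have hd : Primrec fun m : ℕ => decide (m = 0) :=
    (Primrec.eq.comp Primrec.id (Primrec.const 0)).decide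
  have hq' : Partrec fun (q : (α × ℕ) × ℕ) => (F q.1.1
      (Nat.pair q.1.2.unpair.1 (q.2 + q.1.2.unpair.2))).map fun m => decide (m = 0) :=
    Partrec.map hq (hd.comp Primrec.snd).to_comp.to₂
  have := Partrec.map (Partrec.rfind hq'.to₂) hadd.to_comp.to₂
  exact this

/-- Evaluation with a parameter for the oracle is partial recursive. -/
theorem partrec_eval_param {α : Type} [Primcodable α] {o : α → ℕ →. ℕ} (ho : Partrec₂ o)
    (c : OracleCode) : Partrec₂ fun (a : α) (n : ℕ) => c.eval (o a) n := by
  induction c with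
  | zero => exact (Computable.const 0).partrec
  | succ => exact (Computable.succ.comp Computable.snd).partrec
  | left => exact (Computable.fst.comp (Computable.unpair.comp Computable.snd)).partrec
  | right => exact (Computable.snd.comp (Computable.unpair.comp Computable.snd)).partrec
  | oracle => exact ho
  | pair cf cg hf hg =>
    have : Partrec fun p : α × ℕ => (cf.eval (o p.1) p.2).bind fun a =>
        (cg.eval (o p.1) p.2).map fun b => Nat.pair a b := by
      refine Partrec.bind hf (Partrec.map (Partrec.comp hg Computable.fst) ?_)
      exact (Primrec₂.natPair.to_comp.comp (Computable.snd.comp Computable.fst) Computable.snd)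
    refine this.of_eq fun p => ?_
    simp [OracleCode.eval, Seq.seq]
  | comp cf cg hf hg =>
    exact Partrec.bind hg (Partrec₂.comp hf (Computable.fst.comp Computable.fst) Computable.snd)
  | prec cf cg hf hg =>
    have : Partrec fun p : α × ℕ => (p.2.unpair.2).rec (cf.eval (o p.1) p.2.unpair.1)
        (fun y IH => IH.bind fun i =>
          cg.eval (o p.1) (Nat.pair p.2.unpair.1 (Nat.pair y i))) := by
      refine Partrec.nat_rec (f := fun p : α × ℕ => p.2.unpair.2)
        (g := fun p : α × ℕ => cf.eval (o p.1) p.2.unpair.1)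
        (h := fun (p : α × ℕ) (q : ℕ × ℕ) =>
          cg.eval (o p.1) (Nat.pair p.2.unpair.1 (Nat.pair q.1 q.2))) ?_ ?_ ?_
      · exact Computable.snd.comp (Computable.unpair.comp Computable.snd)
      · exact Partrec₂.comp hf Computable.fst
          (Computable.fst.comp (Computable.unpair.comp Computable.snd))
      · refine Partrec₂.comp hg (Computable.fst.comp Computable.fst) ?_
        refine Primrec₂.natPair.to_comp.comp (Computable.fst.comp (Computable.unpair.comp
          (Computable.snd.comp Computable.fst))) ?_
        exact Primrec₂.natPair.to_comp.comp (Computable.fst.comp Computable.snd)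
          (Computable.snd.comp Computable.snd)
    exact this
  | rfind' cf hf =>
    exact partrec_rfind_param hf

theorem partrec_str (c : OracleCode) :
    Partrec₂ fun (τ : List Bool) (n : ℕ) => c.eval (strOracle τ) n := by
  refine partrec_eval_param ?_ c
  have : Partrec fun p : List Bool × ℕ =>
      (((p.1[p.2]?).map fun b => cond b 1 0 : Option ℕ) : Part ℕ) :=
    Computable.ofOption (Primrec.option_map (f := fun p : List Bool × ℕ => p.1[p.2]?)
      (g := fun _ b => cond b 1 0) Primrec.list_getElem?
      ((Primrec.dom_bool fun b => cond b 1 0).comp₂ Primrec₂.right)).to_comp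
  refine this.of_eq fun p => ?_
  ext v
  rw [mem_strOracle]
  simp [eq_comm]

theorem partrec_empty (c : OracleCode) :
    Partrec fun (n : ℕ) => c.eval (chi fun _ => false) n :=
  (partrec_eval_param (α := Unit) (o := fun _ => chi fun _ => false)
    (Computable.const 0).partrec c).comp (Computable.const ()) Computable.id

theorem exists_code {f : ℕ →. ℕ} (hf : Nat.Partrec f) :
    ∃ c : OracleCode, ∀ g, c.eval g = f := by
  obtain ⟨c, rfl⟩ := Nat.Partrec.Code.exists_code.1 hf
  clear hf
  induction c with
  | zero => exact ⟨.zero, fun g => rfl⟩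
  | succ => exact ⟨.succ, fun g => rfl⟩
  | left => exact ⟨.left, fun g => rfl⟩
  | right => exact ⟨.right, fun g => rfl⟩
  | pair _ _ hf hg =>
    obtain ⟨cf, hf⟩ := hf; obtain ⟨cg, hg⟩ := hg
    exact ⟨.pair cf cg, fun g => by simp only [OracleCode.eval, hf, hg]; rfl⟩
  | comp _ _ hf hg =>
    obtain ⟨cf, hf⟩ := hf; obtain ⟨cg, hg⟩ := hg
    exact ⟨.comp cf cg, fun g => by simp only [OracleCode.eval, hf, hg]; rfl⟩
  | prec _ _ hf hg =>
    obtain ⟨cf, hf⟩ := hf; obtain ⟨cg, hg⟩ := hg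
    exact ⟨.prec cf cg, fun g => by simp only [OracleCode.eval, hf, hg]; rfl⟩
  | rfind' _ hf =>
    obtain ⟨cf, hf⟩ := hf
    exact ⟨.rfind' cf, fun g => by simp only [OracleCode.eval, hf]; rfl⟩

section Hierarchy
variable {α β : Type} [Primcodable α] [Primcodable β]

/-- `Σ⁰₁` predicates, in normal form. -/
def Sig1 {α : Type} [Primcodable α] (p : α → Prop) : Prop :=
  ∃ R : α → ℕ → Prop, PrimrecRel R ∧ ∀ a, p a ↔ ∃ s, R a s

theorem Sig1.of_eq {p q : α → Prop} (hp : Sig1 p) (h : ∀ a, p a ↔ q a) : Sig1 q := by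
  obtain ⟨R, hR, hp⟩ := hp
  exact ⟨R, hR, fun a => (h a).symm.trans (hp a)⟩

theorem Sig1.of_prim {p : α → Prop} (hp : PrimrecPred p) : Sig1 p :=
  ⟨fun a _ => p a, hp.comp Primrec.fst, fun a => by simp⟩

theorem Sig1.comp {p : β → Prop} {f : α → β} (hp : Sig1 p) (hf : Primrec f) :
    Sig1 fun a => p (f a) := by
  obtain ⟨R, hR, hp⟩ := hp
  exact ⟨fun a s => R (f a) s, hR.comp (hf.comp Primrec.fst) Primrec.snd, fun a => hp _⟩

theorem Sig1.and {p q : α → Prop} (hp : Sig1 p) (hq : Sig1 q) : Sig1 fun a => p a ∧ q a := by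
  obtain ⟨R, hR, hp⟩ := hp
  obtain ⟨S, hS, hq⟩ := hq
  refine ⟨fun a s => R a s.unpair.1 ∧ S a s.unpair.2, ?_, fun a => ?_⟩
  · exact PrimrecPred.and
      (hR.comp Primrec.fst (Primrec.fst.comp (Primrec.unpair.comp Primrec.snd)))
      (hS.comp Primrec.fst (Primrec.snd.comp (Primrec.unpair.comp Primrec.snd)))
  · simp only [hp, hq]
    constructor
    · rintro ⟨⟨s, hs⟩, t, ht⟩
      exact ⟨Nat.pair s t, by simpa using ⟨hs, ht⟩⟩
    · rintro ⟨s, h1, h2⟩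
      exact ⟨⟨_, h1⟩, _, h2⟩

theorem Sig1.or {p q : α → Prop} (hp : Sig1 p) (hq : Sig1 q) : Sig1 fun a => p a ∨ q a := by
  obtain ⟨R, hR, hp⟩ := hp
  obtain ⟨S, hS, hq⟩ := hq
  refine ⟨fun a s => R a s ∨ S a s, PrimrecPred.or hR hS, fun a => ?_⟩
  simp only [hp, hq, exists_or]

theorem Sig1.ex {p : α × β → Prop} (hp : Sig1 p) : Sig1 fun a => ∃ b, p (a, b) := by
  obtain ⟨R, hR, hp⟩ := hp
  have h1 : PrimrecRel fun (b : β) (q : α × ℕ) => R (q.1, b) q.2.unpair.2 :=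
    hR.comp (Primrec.pair (Primrec.fst.comp Primrec.snd) Primrec.fst)
      (Primrec.snd.comp (Primrec.unpair.comp (Primrec.snd.comp Primrec.snd)))
  have h2 := h1.exists_mem_list
  have h3 : Primrec fun q : α × ℕ => (Encodable.decode (α := β) q.2.unpair.1).toList :=
    Primrec.optionToList.comp (Primrec.decode.comp
      (Primrec.fst.comp (Primrec.unpair.comp Primrec.snd)))
  refine ⟨fun a s => ∃ b ∈ (Encodable.decode (α := β) s.unpair.1).toList, R (a, b) s.unpair.2,
    h2.comp h3 Primrec.id, fun a => ?_⟩
  constructor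
  · rintro ⟨b, hb⟩
    obtain ⟨s, hs⟩ := (hp _).1 hb
    exact ⟨Nat.pair (Encodable.encode b) s, b, by simp, by simpa using hs⟩
  · rintro ⟨s, b, _, hb⟩
    exact ⟨b, (hp _).2 ⟨_, hb⟩⟩

theorem Sig1.ball {p : β × α → Prop} {l : α → List β} (hp : Sig1 p) (hl : Primrec l) :
    Sig1 fun a => ∀ b ∈ l a, p (b, a) := by
  obtain ⟨R, hR, hp⟩ := hp
  have h0 : PrimrecRel fun (t : ℕ) (q : β × α) => R q t := hR.comp Primrec.snd Primrec.fst
  have h00 : PrimrecRel fun (n : ℕ) (q : β × α) => ∃ t < n, R q t := by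
    have h02 : PrimrecPred fun y : ℕ × (β × α) => ∃ t ∈ List.range y.1, R y.2 t :=
      h0.exists_mem_list.comp (Primrec.list_range.comp Primrec.fst) Primrec.snd
    simp only [List.mem_range] at h02
    exact h02
  have h01 : PrimrecPred fun y : β × (α × ℕ) => ∃ t < y.2.2, R (y.1, y.2.1) t :=
    h00.comp (Primrec.snd.comp Primrec.snd)
      (Primrec.pair Primrec.fst (Primrec.fst.comp Primrec.snd))
  have h1 : PrimrecRel fun (b : β) (q : α × ℕ) => ∃ t < q.2, R (b, q.1) t := h01
  refine ⟨fun a s => ∀ b ∈ l a, ∃ t < s, R (b, a) t,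
    h1.forall_mem_list.comp (hl.comp Primrec.fst) Primrec.id, fun a => ?_⟩
  constructor
  · intro h
    dsimp only at h ⊢
    generalize l a = L at h ⊢
    induction L with
    | nil => exact ⟨0, by simp⟩
    | cons b L ih =>
      obtain ⟨s, hs⟩ := ih fun c hc => h c (by simp [hc])
      obtain ⟨t, ht⟩ := (hp _).1 (h b (by simp))
      refine ⟨max s (t + 1), fun c hc => ?_⟩
      rcases List.mem_cons.1 hc with rfl | hc
      · exact ⟨t, by omega, ht⟩
      · obtain ⟨t', h1, h2⟩ := hs c hc
        exact ⟨t', by omega, h2⟩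
  · rintro ⟨s, hs⟩ b hb
    obtain ⟨t, _, ht⟩ := hs b hb
    exact (hp _).2 ⟨t, ht⟩

theorem Sig1.of_partrec {f : α →. ℕ} (hf : Partrec f) : Sig1 fun q : α × ℕ => q.2 ∈ f q.1 := by
  obtain ⟨c, hc⟩ := Nat.Partrec.Code.exists_code.1 hf
  refine ⟨fun q s => Nat.Partrec.Code.evaln s c (Encodable.encode q.1) = some q.2, ?_, fun q => ?_⟩
  · refine Primrec.eq.comp (Nat.Partrec.Code.primrec_evaln.comp (Primrec.pair
      (Primrec.pair Primrec.snd (Primrec.const c))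
      (Primrec.encode.comp (Primrec.fst.comp Primrec.fst)))) ?_
    exact Primrec.option_some.comp (Primrec.snd.comp Primrec.fst)
  · have := congrFun hc (Encodable.encode q.1)
    have h2 : q.2 ∈ f q.1 ↔ q.2 ∈ Nat.Partrec.Code.eval c (Encodable.encode q.1) := by
      rw [this]; simp
    exact h2.trans Nat.Partrec.Code.evaln_complete

theorem Sig1.exists_partrec {p : ℕ → Prop} (hp : Sig1 p) :
    ∃ f : ℕ →. ℕ, Nat.Partrec f ∧ ∀ n, (f n).Dom ↔ p n := by
  classical
  obtain ⟨R, hR, hp⟩ := hp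
  have h1 : Primrec₂ fun n s => decide (R n s) := hR.decide
  have h2 := Partrec.rfind (p := fun n s => Part.some (decide (R n s))) h1.to_comp.partrec₂
  refine ⟨_, Partrec.nat_iff.1 h2, fun n => ?_⟩
  refine Nat.rfind_dom'.trans ?_
  simp [hp]

/-- `Σ⁰₂` predicates. -/
def Sig2 {α : Type} [Primcodable α] (p : α → Prop) : Prop :=
  ∃ q : α × ℕ → Prop, Sig1 q ∧ ∀ a, p a ↔ ∃ s, ¬ q (a, s)

theorem Sig2.of_eq {p q : α → Prop} (hp : Sig2 p) (h : ∀ a, p a ↔ q a) : Sig2 q := by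
  obtain ⟨R, hR, hp⟩ := hp
  exact ⟨R, hR, fun a => (h a).symm.trans (hp a)⟩

theorem Sig2.of_co {p : α → Prop} (hp : Sig1 p) : Sig2 fun a => ¬ p a :=
  ⟨fun q => p q.1, hp.comp Primrec.fst, fun a => by simp⟩

theorem Sig2.of_sig1 {p : α → Prop} (hp : Sig1 p) : Sig2 p := by
  obtain ⟨R, hR, hp⟩ := hp
  exact ⟨fun q => ¬ R q.1 q.2, Sig1.of_prim (PrimrecPred.not hR), fun a => by simp [hp]⟩

theorem Sig2.comp {p : β → Prop} {f : α → β} (hp : Sig2 p) (hf : Primrec f) :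
    Sig2 fun a => p (f a) := by
  obtain ⟨q, hq, hp⟩ := hp
  exact ⟨fun a => q (f a.1, a.2), hq.comp (Primrec.pair (hf.comp Primrec.fst) Primrec.snd),
    fun a => hp _⟩

theorem Sig2.and {p q : α → Prop} (hp : Sig2 p) (hq : Sig2 q) : Sig2 fun a => p a ∧ q a := by
  obtain ⟨R, hR, hp⟩ := hp
  obtain ⟨S, hS, hq⟩ := hq
  refine ⟨fun a => R (a.1, a.2.unpair.1) ∨ S (a.1, a.2.unpair.2), ?_, fun a => ?_⟩
  · exact Sig1.or
      (hR.comp (Primrec.pair Primrec.fst (Primrec.fst.comp (Primrec.unpair.comp Primrec.snd))))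
      (hS.comp (Primrec.pair Primrec.fst (Primrec.snd.comp (Primrec.unpair.comp Primrec.snd))))
  · simp only [hp, hq]
    constructor
    · rintro ⟨⟨s, hs⟩, t, ht⟩
      exact ⟨Nat.pair s t, by simpa using ⟨hs, ht⟩⟩
    · rintro ⟨s, h⟩
      rw [not_or] at h
      exact ⟨⟨_, h.1⟩, _, h.2⟩

theorem Sig2.ex {p : α × β → Prop} (hp : Sig2 p) : Sig2 fun a => ∃ b, p (a, b) := by
  obtain ⟨q, hq, hp⟩ := hp
  have h1 : Sig1 fun r : β × (α × ℕ) => q ((r.2.1, r.1), r.2.2.unpair.2) :=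
    hq.comp (Primrec.pair (Primrec.pair (Primrec.fst.comp Primrec.snd) Primrec.fst)
      (Primrec.snd.comp (Primrec.unpair.comp (Primrec.snd.comp Primrec.snd))))
  have h3 : Primrec fun q : α × ℕ => (Encodable.decode (α := β) q.2.unpair.1).toList :=
    Primrec.optionToList.comp (Primrec.decode.comp
      (Primrec.fst.comp (Primrec.unpair.comp Primrec.snd)))
  refine ⟨_, h1.ball h3, fun a => ?_⟩
  constructor
  · rintro ⟨b, hb⟩
    obtain ⟨s, hs⟩ := (hp _).1 hb
    exact ⟨Nat.pair (Encodable.encode b) s, fun h => hs (by simpa using h b (by simp))⟩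
  · rintro ⟨s, h⟩
    push Not at h
    obtain ⟨b, _, hb⟩ := h
    exact ⟨b, (hp _).2 ⟨_, hb⟩⟩

theorem Sig2.uniformize {p : α × β → Prop} (hp : Sig2 p) :
    ∃ q : α × β → Prop, Sig2 q ∧ (∀ a b, q (a, b) → p (a, b)) ∧
      (∀ a b b', q (a, b) → q (a, b') → b = b') ∧ ∀ a b, p (a, b) → ∃ b', q (a, b') := by
  classical
  obtain ⟨r, hr, hp⟩ := hp
  have hB : Sig1 fun x : ℕ × α =>
      ∀ b ∈ (Encodable.decode₂ β x.1.unpair.1).toList, r ((x.2, b), x.1.unpair.2) := by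
    have h1 : Sig1 fun y : β × (ℕ × α) => r ((y.2.2, y.1), y.2.1.unpair.2) :=
      hr.comp (Primrec.pair (Primrec.pair (Primrec.snd.comp Primrec.snd) Primrec.fst)
        (Primrec.snd.comp (Primrec.unpair.comp (Primrec.fst.comp Primrec.snd))))
    have h3 : Primrec fun x : ℕ × α => (Encodable.decode₂ β x.1.unpair.1).toList :=
      Primrec.optionToList.comp (Primrec.decode₂.comp
        (Primrec.fst.comp (Primrec.unpair.comp Primrec.fst)))
    exact h1.ball h3
  generalize hBd : (fun x : ℕ × α =>
      ∀ b ∈ (Encodable.decode₂ β x.1.unpair.1).toList, r ((x.2, b), x.1.unpair.2)) = B at hB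
  have hBe : ∀ b s a, B (Nat.pair (Encodable.encode b) s, a) ↔ r ((a, b), s) := by
    intro b s a
    rw [← hBd]
    simp
  have hBw : ∀ w a, ¬ B (w, a) → ∃ (b : β) (s : ℕ), w = Nat.pair (Encodable.encode b) s := by
    intro w a h
    rw [← hBd] at h
    push Not at h
    obtain ⟨b, hb, -⟩ := h
    refine ⟨b, w.unpair.2, ?_⟩
    have hb := Encodable.mem_decode₂.1 (Option.mem_toList.1 hb)
    dsimp only at hb
    rw [hb, Nat.pair_unpair]
  -- `w` is the least witness for `a`
  let Lst : ℕ × α → Prop := fun x => ¬ B x ∧ ∀ w ∈ List.range x.1, B (w, x.2)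
  have hL : Sig2 Lst := by
    refine (Sig2.of_co hB).and (Sig2.of_sig1 ?_)
    have h1 : Sig1 fun y : ℕ × (ℕ × α) => B (y.1, y.2.2) :=
      hB.comp (Primrec.pair Primrec.fst (Primrec.snd.comp Primrec.snd))
    exact h1.ball (Primrec.list_range.comp Primrec.fst)
  have hLu : ∀ a w w', Lst (w, a) → Lst (w', a) → w = w' := by
    rintro a w w' ⟨h1, h2⟩ ⟨h3, h4⟩
    rcases lt_trichotomy w w' with h | h | h
    · exact absurd (h4 w (by simpa using h)) h1
    · exact h
    · exact absurd (h2 w' (by simpa using h)) h3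
  refine ⟨fun x => ∃ s, Lst (Nat.pair (Encodable.encode x.2) s, x.1), ?_, ?_, ?_, ?_⟩
  · refine Sig2.ex (p := fun y : (α × β) × ℕ =>
      Lst (Nat.pair (Encodable.encode y.1.2) y.2, y.1.1)) ?_
    exact hL.comp (Primrec.pair (Primrec₂.natPair.comp
      (Primrec.encode.comp (Primrec.snd.comp Primrec.fst)) Primrec.snd)
      (Primrec.fst.comp Primrec.fst))
  · rintro a b ⟨s, h1, -⟩
    rw [hBe] at h1
    exact (hp _).2 ⟨s, h1⟩
  · rintro a b b' ⟨s, h⟩ ⟨s', h'⟩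
    have := hLu _ _ _ h h'
    exact Encodable.encode_injective (Nat.pair_eq_pair.1 this).1
  · intro a b hb
    obtain ⟨s, hs⟩ := (hp _).1 hb
    rw [← hBe] at hs
    have hex : ∃ w, ¬ B (w, a) := ⟨_, hs⟩
    obtain ⟨b', s', hw⟩ := hBw _ _ (Nat.find_spec hex)
    refine ⟨b', s', ?_⟩
    dsimp only
    rw [← hw]
    refine ⟨Nat.find_spec hex, fun w hw => ?_⟩
    have := Nat.find_min hex (by simpa using hw)
    simpa using this

end Hierarchy

theorem encodeCode_injective : ∀ c d : OracleCode, c.encodeCode = d.encodeCode → c = d := by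
  intro c
  induction c with
  | zero | succ | left | right | oracle =>
    intro d h; cases d <;> simp [OracleCode.encodeCode] at h ⊢ <;> omega
  | pair cf cg hf hg | comp cf cg hf hg | prec cf cg hf hg =>
    intro d h
    cases d <;> simp only [OracleCode.encodeCode] at h <;> first | omega | skip
    simp only [Nat.add_right_cancel_iff, mul_eq_mul_left_iff, Nat.pair_eq_pair,
      OfNat.ofNat_ne_zero, or_false] at h
    rw [hf _ h.1, hg _ h.2]
  | rfind' cf hf =>
    intro d h
    cases d <;> simp only [OracleCode.encodeCode] at h <;> first | omega | skip
    simp only [Nat.add_right_cancel_iff, mul_eq_mul_left_iff, Nat.pair_eq_pair,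
      OfNat.ofNat_ne_zero, or_false] at h
    rw [hf _ h.1]

theorem eval_comp_some {g : ℕ →. ℕ} {cf cg : OracleCode} {n m : ℕ}
    (h : cg.eval g n = Part.some m) : (OracleCode.comp cf cg).eval g n = cf.eval g m := by
  ext v
  rw [OracleCode.mem_comp, h]
  simp

/-- A code for the constant function `n`. -/
def constCode : ℕ → OracleCode
  | 0 => .zero
  | n + 1 => .comp .succ (constCode n)

theorem eval_constCode (g : ℕ →. ℕ) (n m : ℕ) : (constCode n).eval g m = Part.some n := by
  induction n with
  | zero => rfl
  | succ n ih =>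
    rw [constCode, eval_comp_some ih]
    rfl

theorem primrec_constCode : Primrec fun n => (constCode n).encodeCode := by
  have h : Primrec fun n : ℕ => Nat.rec (motive := fun _ => ℕ) 0
      (fun _ e => 4 * Nat.pair 1 e + 6) n := by
    refine Primrec.nat_rec₁ 0 ?_
    exact Primrec.nat_add.comp (Primrec.nat_mul.comp (Primrec.const 4)
      (Primrec₂.natPair.comp (Primrec.const 1) Primrec.snd)) (Primrec.const 6)
  refine h.of_eq fun n => ?_
  induction n with
  | zero => rfl
  | succ n ih => simp only [constCode, OracleCode.encodeCode, ← ih]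

theorem Sig2.exists_code {p : ℕ → Prop} (hp : Sig2 p) :
    ∃ c : OracleCode, ∀ n, p n ↔ (c.eval (chi zeroJump) n).Dom := by
  obtain ⟨q, hq, hp⟩ := hp
  obtain ⟨f, hf, hfq⟩ := (hq.comp Primrec.unpair).exists_partrec
  obtain ⟨c0, hc0⟩ := TypicalDegree.exists_code hf
  have hh : Primrec fun a => (OracleCode.comp c0 (constCode a)).encodeCode := by
    exact Primrec.nat_add.comp (Primrec.nat_mul.comp (Primrec.const 4)
      (Primrec₂.natPair.comp (Primrec.const c0.encodeCode) primrec_constCode)) (Primrec.const 6)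
  obtain ⟨ch, hch⟩ := TypicalDegree.exists_code (Nat.Partrec.of_primrec (Primrec.nat_iff.1 hh))
  have hj : ∀ a, zeroJump (OracleCode.comp c0 (constCode a)).encodeCode = true ↔ q a.unpair := by
    intro a
    rw [← hfq]
    simp only [zeroJump, jump, decide_eq_true_eq]
    have key : ∀ x, ((OracleCode.comp c0 (constCode a)).eval (chi fun _ => false) x) = f a := by
      intro x
      rw [eval_comp_some (eval_constCode _ _ _), hc0]
    constructor
    · rintro ⟨c, h1, h2⟩
      rw [encodeCode_injective _ _ h1, key] at h2
      exact h2
    · intro h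
      exact ⟨_, rfl, by rw [key]; exact h⟩
  have hquery : ∀ a, (OracleCode.comp .oracle ch).eval (chi zeroJump) a =
      Part.some (cond (zeroJump (OracleCode.comp c0 (constCode a)).encodeCode) 1 0) := by
    intro a
    rw [eval_comp_some (m := (OracleCode.comp c0 (constCode a)).encodeCode) (by rw [hch]; rfl)]
    rfl
  refine ⟨.comp (.rfind' (.comp .oracle ch)) (.pair (.pair .left .right) .zero), fun n => ?_⟩
  have hin : (OracleCode.pair (.pair .left .right) .zero).eval (chi zeroJump) n =
      Part.some (Nat.pair n 0) := by
    rw [Part.eq_some_iff, OracleCode.mem_pair]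
    refine ⟨n, ?_, 0, by simp [OracleCode.eval, pure, PFun.pure], rfl⟩
    rw [OracleCode.mem_pair]
    exact ⟨n.unpair.1, by simp [OracleCode.eval], n.unpair.2, by simp [OracleCode.eval], by simp⟩
  have hev : (OracleCode.comp (.rfind' (.comp .oracle ch)) (.pair (.pair .left .right) .zero)).eval
      (chi zeroJump) n = (OracleCode.rfind' (.comp .oracle ch)).eval (chi zeroJump)
        (Nat.pair n 0) := by
    exact eval_comp_some hin
  classical
  rw [hev, hp, Part.dom_iff_mem]
  constructor
  · intro h
    refine ⟨Nat.find h, OracleCode.mem_rfind'.2 ⟨Nat.find h, rfl, ?_, fun j hj' => ?_⟩⟩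
    · rw [hquery]
      have := Nat.find_spec h
      have h2 := hj (Nat.pair n (Nat.find h))
      rw [Nat.unpair_pair] at h2
      rw [← h2] at this
      simp at this
      simp [this]
    · have := Nat.find_min h hj'
      have h2 := hj (Nat.pair n j)
      rw [Nat.unpair_pair] at h2
      rw [not_not, ← h2] at this
      refine ⟨1, by simp, ?_⟩
      rw [hquery]
      simp [this]
  · rintro ⟨v, hv⟩
    obtain ⟨k, -, h0, -⟩ := OracleCode.mem_rfind'.1 hv
    refine ⟨k, fun h => ?_⟩
    have h2 := hj (Nat.pair n k)
    rw [Nat.unpair_pair] at h2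
    rw [hquery] at h0
    simp [h2.2 h] at h0

theorem Sig2.ceIn {W : Set (List Bool)} (h : Sig2 fun σ => σ ∈ W) : CEIn zeroJump W := by
  have h1 : Sig2 fun n : ℕ => (Encodable.decode (α := List Bool) n).getD [] ∈ W :=
    h.comp (Primrec.option_getD.comp Primrec.decode (Primrec.const []))
  obtain ⟨c, hc⟩ := h1.exists_code
  refine ⟨c, fun σ => ?_⟩
  rw [← hc]
  simp

theorem Sig2.uniformCEIn {V : ℕ → Set (List Bool)}
    (h : Sig2 fun x : ℕ × List Bool => x.2 ∈ V x.1) : UniformCEIn zeroJump V := by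
  have h1 : Sig2 fun n : ℕ =>
      (Encodable.decode (α := List Bool) n.unpair.2).getD [] ∈ V n.unpair.1 :=
    h.comp (Primrec.pair (Primrec.fst.comp Primrec.unpair)
      (Primrec.option_getD.comp (Primrec.decode.comp (Primrec.snd.comp Primrec.unpair))
        (Primrec.const [])))
  obtain ⟨c, hc⟩ := h1.exists_code
  refine ⟨c, fun i σ => ?_⟩
  rw [← hc]
  simp

/-! ### Counting strings -/

theorem length_le_two_pow {L : List (List Bool)} {m : ℕ} (hL : L.Nodup)
    (h : ∀ ξ ∈ L, ξ.length = m) : L.length ≤ 2 ^ m := by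
  classical
  have h1 : L.toFinset ⊆ (Finset.univ : Finset (Fin m → Bool)).image fun f => List.ofFn f := by
    intro ξ hξ
    have h2 := h ξ (by simpa using hξ)
    subst h2
    exact Finset.mem_image.2 ⟨ξ.get, Finset.mem_univ _, List.ofFn_get ξ⟩
  have h2 := (Finset.card_le_card h1).trans Finset.card_image_le
  rw [List.toFinset_card_of_nodup hL] at h2
  simpa using h2

theorem stringMeasure_le (V : Set (List Bool)) (S : ℕ → Set (List Bool)) (k : ℕ)
    (hV : ∀ ξ ∈ V, ∀ η, ξ <+: η → ∃ e, η ∈ S e)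
    (hS : ∀ e n (L : List (List Bool)), L.Nodup → (∀ ξ ∈ L, ξ.length = n ∧ ξ ∈ S e) →
      L.length * 2 ^ (e + k + 2) ≤ 2 ^ n) : stringMeasure V < (2 : ℝ≥0∞)⁻¹ ^ k := by
  classical
  have hmain : stringMeasure V ≤ (2 : ℝ≥0∞)⁻¹ ^ (k + 1) := by
    refine iSup_le fun n => ?_
    let T : Finset (Fin n → Bool) := Finset.univ.filter fun f => ∃ σ ∈ V, σ <+: List.ofFn f
    have hT : Nat.card {f : Fin n → Bool // ∃ σ ∈ V, σ <+: List.ofFn f} = T.card := by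
      rw [Nat.card_eq_fintype_card, Fintype.card_subtype]
    rw [hT]
    let F : ℕ → Finset (Fin n → Bool) := fun e => Finset.univ.filter fun f => List.ofFn f ∈ S e
    have hF : ∀ e, (F e).card * 2 ^ (e + k + 2) ≤ 2 ^ n := by
      intro e
      have := hS e n ((F e).toList.map fun f => List.ofFn f)
        ((Finset.nodup_toList _).map List.ofFn_injective) (by
          intro ξ hξ
          obtain ⟨f, hf, rfl⟩ := List.mem_map.1 hξ
          refine ⟨by simp, ?_⟩
          have := (Finset.mem_toList.1 hf)
          simpa [F] using this)
      simpa using this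
    have hTe : ∀ f : Fin n → Bool, ∃ e, f ∈ T → f ∈ F e := by
      intro f
      by_cases hf : f ∈ T
      · obtain ⟨σ, h1, h2⟩ := (Finset.mem_filter.1 hf).2
        obtain ⟨e, he⟩ := hV σ h1 _ h2
        exact ⟨e, fun _ => Finset.mem_filter.2 ⟨Finset.mem_univ _, he⟩⟩
      · exact ⟨0, fun h => absurd h hf⟩
    choose e he using hTe
    have hsub : T ⊆ (T.image e).biUnion F := fun f hf =>
      Finset.mem_biUnion.2 ⟨e f, Finset.mem_image_of_mem _ hf, he f hf⟩
    have hc : T.card ≤ ∑ i ∈ T.image e, (F i).card :=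
      (Finset.card_le_card hsub).trans Finset.card_biUnion_le
    have hFe : ∀ i, ((F i).card : ℝ≥0∞) ≤ 2 ^ n * (2⁻¹ ^ (k + 2) * 2⁻¹ ^ i) := by
      intro i
      have h1 : ((F i).card : ℝ≥0∞) * 2 ^ (i + k + 2) ≤ 2 ^ n := by exact_mod_cast hF i
      have h2 : ((F i).card : ℝ≥0∞) ≤ 2 ^ n / 2 ^ (i + k + 2) :=
        (ENNReal.le_div_iff_mul_le (Or.inl (by simp)) (Or.inl (by finiteness))).2 h1
      refine h2.trans (le_of_eq ?_)
      rw [div_eq_mul_inv, ENNReal.inv_pow, ← pow_add]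
      congr 2
      omega
    refine ENNReal.div_le_of_le_mul ?_
    calc (T.card : ℝ≥0∞) ≤ ∑ i ∈ T.image e, ((F i).card : ℝ≥0∞) := by exact_mod_cast hc
      _ ≤ ∑ i ∈ T.image e, 2 ^ n * (2⁻¹ ^ (k + 2) * 2⁻¹ ^ i) :=
        Finset.sum_le_sum fun i _ => hFe i
      _ ≤ ∑' i : ℕ, (2 : ℝ≥0∞) ^ n * (2⁻¹ ^ (k + 2) * 2⁻¹ ^ i) := ENNReal.sum_le_tsum _
      _ = 2⁻¹ ^ (k + 1) * 2 ^ n := by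
        rw [ENNReal.tsum_mul_left, ENNReal.tsum_mul_left, ENNReal.tsum_geometric,
          ENNReal.one_sub_inv_two, inv_inv, mul_comm]
        congr 1
        rw [pow_succ, mul_assoc, ENNReal.inv_mul_cancel (by simp) (by simp), mul_one]
  refine hmain.trans_lt ?_
  rw [pow_succ]
  calc (2 : ℝ≥0∞)⁻¹ ^ k * 2⁻¹ < 2⁻¹ ^ k * 1 := by
        refine (ENNReal.mul_lt_mul_iff_right (by simp) (by finiteness)).2 ?_
        simp
    _ = _ := mul_one _

theorem stringMeasure_singleton (σ : List Bool) (k : ℕ) (h : σ.length = k + 2) :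
    stringMeasure {σ} < (2 : ℝ≥0∞)⁻¹ ^ k := by
  refine stringMeasure_le _ (fun e => {η | e = 0 ∧ σ <+: η}) k ?_ ?_
  · rintro ξ rfl η hη
    exact ⟨0, rfl, hη⟩
  · intro e n L hL hL2
    rcases L.eq_nil_or_concat with rfl | ⟨L', ξ, hc⟩
    · simp
    have hξ := hL2 ξ (by simp [hc])
    have he : e = 0 := hξ.2.1
    have hn : k + 2 ≤ n := by
      have := hξ.2.2.length_le
      omega
    have h1 : (L.map (List.drop (k + 2))).length ≤ 2 ^ (n - (k + 2)) := by
      refine length_le_two_pow ?_ ?_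
      · refine List.Nodup.map_on ?_ hL
        intro x hx y hy hxy
        obtain ⟨a, rfl⟩ := (hL2 x hx).2.2
        obtain ⟨b, rfl⟩ := (hL2 y hy).2.2
        rw [← h, List.drop_left, List.drop_left] at hxy
        rw [hxy]
      · intro x hx
        obtain ⟨y, hy, rfl⟩ := List.mem_map.1 hx
        rw [List.length_drop, (hL2 y hy).1]
    rw [List.length_map] at h1
    calc L.length * 2 ^ (e + k + 2) ≤ 2 ^ (n - (k + 2)) * 2 ^ (k + 2) := by
          rw [he, zero_add]; exact Nat.mul_le_mul_right _ h1
      _ = 2 ^ n := by rw [← pow_add]; congr 1; omega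

/-! ### Satisfying finite conditions -/

/-- `ξ` forces the finite condition `ρ` through the functional `c`. -/
def Sat (c : OracleCode) (ξ : List Bool) (ρ : List (ℕ × ℕ)) : Prop :=
  ∀ p ∈ ρ, p.2 ∈ c.eval (strOracle ξ) p.1

theorem Sat.mono {c : OracleCode} {ξ η : List Bool} {ρ : List (ℕ × ℕ)} (h : Sat c ξ ρ)
    (hp : ξ <+: η) : Sat c η ρ := fun p hpρ => eval_str_mono hp (h p hpρ)

/-- There are more than `2 ^ (m - j)` many strings of length `m` forcing `ρ`. -/
def ThickAt (c : OracleCode) (j : ℕ) (ρ : List (ℕ × ℕ)) (m : ℕ) : Prop :=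
  ∃ L : List (List Bool), L.Nodup ∧ (∀ ξ ∈ L, ξ.length = m ∧ Sat c ξ ρ) ∧
    2 ^ m < L.length * 2 ^ j

def Thick (c : OracleCode) (j : ℕ) (ρ : List (ℕ × ℕ)) : Prop := ∃ m, ThickAt c j ρ m

theorem ThickAt.succ {c : OracleCode} {j : ℕ} {ρ : List (ℕ × ℕ)} {m : ℕ}
    (h : ThickAt c j ρ m) : ThickAt c j ρ (m + 1) := by
  obtain ⟨L, h1, h2, h3⟩ := h
  refine ⟨L.map (· ++ [true]) ++ L.map (· ++ [false]), ?_, ?_, ?_⟩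
  · refine List.Nodup.append (h1.map fun x y h => by simpa using h)
      (h1.map fun x y h => by simpa using h) ?_
    intro x hx hy
    obtain ⟨a, _, rfl⟩ := List.mem_map.1 hx
    obtain ⟨b, _, hb⟩ := List.mem_map.1 hy
    have := (List.append_inj' hb rfl).2
    simp at this
  · intro ξ hξ
    rcases List.mem_append.1 hξ with h | h
    all_goals
      obtain ⟨a, ha, rfl⟩ := List.mem_map.1 h
      exact ⟨by simp [(h2 a ha).1], (h2 a ha).2.mono ⟨_, rfl⟩⟩
  · simp only [List.length_append, List.length_map, pow_succ]
    linarith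

theorem ThickAt.le {c : OracleCode} {j : ℕ} {ρ : List (ℕ × ℕ)} {m m' : ℕ}
    (h : ThickAt c j ρ m) (hm : m ≤ m') : ThickAt c j ρ m' := by
  induction hm with
  | refl => exact h
  | step _ ih => exact ih.succ

theorem not_thick_nil (c : OracleCode) : ¬ Thick c 0 [] := by
  rintro ⟨m, L, h1, h2, h3⟩
  have := length_le_two_pow h1 fun ξ hξ => (h2 ξ hξ).1
  simp at h3
  omega

theorem thick_split {c : OracleCode} {j : ℕ} {ρ : List (ℕ × ℕ)} {x v₀ v₁ : ℕ} (hv : v₀ ≠ v₁)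
    (h0 : Thick c (j + 1) ((x, v₀) :: ρ)) (h1 : Thick c (j + 1) ((x, v₁) :: ρ)) :
    Thick c j ρ := by
  obtain ⟨m0, h0⟩ := h0
  obtain ⟨m1, h1⟩ := h1
  obtain ⟨L0, a0, b0, c0⟩ := h0.le (le_max_left m0 m1)
  obtain ⟨L1, a1, b1, c1⟩ := h1.le (le_max_right m0 m1)
  refine ⟨max m0 m1, L0 ++ L1, List.Nodup.append a0 a1 ?_, ?_, ?_⟩
  · intro ξ h0 h1
    have e0 := (b0 ξ h0).2 (x, v₀) (by simp)
    have e1 := (b1 ξ h1).2 (x, v₁) (by simp)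
    exact hv (Part.mem_unique e0 e1)
  · intro ξ hξ
    rcases List.mem_append.1 hξ with h | h
    · exact ⟨(b0 ξ h).1, fun p hp => (b0 ξ h).2 p (by simp [hp])⟩
    · exact ⟨(b1 ξ h).1, fun p hp => (b1 ξ h).2 p (by simp [hp])⟩
  · rw [List.length_append]
    rw [pow_succ] at c0 c1
    linarith

theorem density {cA cB : OracleCode} {σ₀ : List Bool}
    (hs : ∀ σ, σ₀ <+: σ → ∃ τ₀ τ₁ : List Bool, ∃ x v₀ v₁ : ℕ, σ <+: τ₀ ∧ σ <+: τ₁ ∧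
      v₀ ∈ cB.eval (strOracle τ₀) x ∧ v₁ ∈ cB.eval (strOracle τ₁) x ∧ v₀ ≠ v₁) (j : ℕ) :
    ∀ σ, σ₀ <+: σ → ∃ τ ρ, σ <+: τ ∧ Sat cB τ ρ ∧ ¬ Thick cA j ρ := by
  induction j with
  | zero => exact fun σ _ => ⟨σ, [], List.prefix_rfl, by simp [Sat], not_thick_nil _⟩
  | succ j ih =>
    intro σ hσ
    obtain ⟨τ, ρ, h1, h2, h3⟩ := ih σ hσ
    obtain ⟨τ₀, τ₁, x, v₀, v₁, e0, e1, f0, f1, hv⟩ := hs τ (hσ.trans h1)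
    by_cases h : Thick cA (j + 1) ((x, v₀) :: ρ)
    · refine ⟨τ₁, (x, v₁) :: ρ, h1.trans e1, ?_, fun h' => h3 (thick_split hv h h')⟩
      intro p hp
      rcases List.mem_cons.1 hp with rfl | hp
      · exact f1
      · exact h2.mono e1 p hp
    · refine ⟨τ₀, (x, v₀) :: ρ, h1.trans e0, ?_, h⟩
      intro p hp
      rcases List.mem_cons.1 hp with rfl | hp
      · exact f0
      · exact h2.mono e0 p hp

/-! ### Complexity of the notions -/

theorem sig1_eval (c : OracleCode) :
    Sig1 fun q : (List Bool × ℕ) × ℕ => q.2 ∈ c.eval (strOracle q.1.1) q.1.2 :=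
  Sig1.of_partrec (f := fun q : List Bool × ℕ => c.eval (strOracle q.1) q.2) (partrec_str c)

theorem sig1_sat (c : OracleCode) : Sig1 fun x : List Bool × List (ℕ × ℕ) => Sat c x.1 x.2 := by
  have h1 : Sig1 fun y : (ℕ × ℕ) × (List Bool × List (ℕ × ℕ)) =>
      y.1.2 ∈ c.eval (strOracle y.2.1) y.1.1 :=
    (sig1_eval c).comp (Primrec.pair (Primrec.pair (Primrec.fst.comp Primrec.snd)
      (Primrec.fst.comp Primrec.fst)) (Primrec.snd.comp Primrec.fst))
  exact h1.ball Primrec.snd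

theorem sig1_isPre : Sig1 fun x : List Bool × List Bool => x.1 <+: x.2 := by
  have h : Sig1 fun y : (List Bool × List Bool) × List Bool => y.1.1 ++ y.2 = y.1.2 :=
    Sig1.of_prim (Primrec.eq.comp (Primrec.list_append.comp (Primrec.fst.comp Primrec.fst)
      Primrec.snd) (Primrec.snd.comp Primrec.fst))
  exact h.ex

theorem sig1_nodup : Sig1 fun L : List (List Bool) => L.Nodup := by
  have h1 : Sig1 fun y : ℕ × (ℕ × List (List Bool)) => ¬ (y.2.2[y.1]? = y.2.2[y.2.1]?) :=
    Sig1.of_prim (PrimrecPred.not (Primrec.eq.comp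
      (Primrec.list_getElem?.comp (Primrec.snd.comp Primrec.snd) Primrec.fst)
      (Primrec.list_getElem?.comp (Primrec.snd.comp Primrec.snd) (Primrec.fst.comp Primrec.snd))))
  have h2 : Sig1 fun y : ℕ × List (List Bool) => ∀ i ∈ List.range y.1, ¬ (y.2[i]? = y.2[y.1]?) :=
    h1.ball (Primrec.list_range.comp Primrec.fst)
  have h3 : Sig1 fun L : List (List Bool) =>
      ∀ j ∈ List.range L.length, ∀ i ∈ List.range j, ¬ (L[i]? = L[j]?) :=
    h2.ball (Primrec.list_range.comp Primrec.list_length)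
  refine h3.of_eq fun L => ?_
  rw [List.nodup_iff_getElem?_ne_getElem?]
  simp only [List.mem_range]
  exact ⟨fun h i j hij hj => h j hj i hij, fun h j hj i hij => h i j hij hj⟩

theorem primrec_two_pow : Primrec fun n : ℕ => 2 ^ n := by
  have h : Primrec fun n : ℕ => Nat.rec (motive := fun _ => ℕ) 1 (fun _ e => e * 2) n :=
    Primrec.nat_rec₁ 1 (Primrec.nat_mul.comp Primrec.snd (Primrec.const 2))
  refine h.of_eq fun n => ?_
  induction n with
  | zero => rfl
  | succ n ih => rw [pow_succ, ← ih]

theorem sig1_thick (c : OracleCode) : Sig1 fun x : ℕ × List (ℕ × ℕ) => Thick c x.1 x.2 := by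
  have hb : Sig1 fun y : ((ℕ × List (ℕ × ℕ)) × ℕ) × List (List Bool) =>
      ∀ ξ ∈ y.2, ξ.length = y.1.2 ∧ Sat c ξ y.1.1.2 := by
    have h1 : Sig1 fun z : List Bool × (((ℕ × List (ℕ × ℕ)) × ℕ) × List (List Bool)) =>
        z.1.length = z.2.1.2 ∧ Sat c z.1 z.2.1.1.2 := by
      refine Sig1.and (Sig1.of_prim (Primrec.eq.comp (Primrec.list_length.comp Primrec.fst)
        (Primrec.snd.comp (Primrec.fst.comp Primrec.snd)))) ?_
      exact (sig1_sat c).comp (Primrec.pair Primrec.fst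
        (Primrec.snd.comp (Primrec.fst.comp (Primrec.fst.comp Primrec.snd))))
    exact h1.ball Primrec.snd
  have hc : Sig1 fun y : ((ℕ × List (ℕ × ℕ)) × ℕ) × List (List Bool) =>
      2 ^ y.1.2 < y.2.length * 2 ^ y.1.1.1 :=
    Sig1.of_prim (Primrec.nat_lt.comp
      (primrec_two_pow.comp (Primrec.snd.comp Primrec.fst))
      (Primrec.nat_mul.comp (Primrec.list_length.comp Primrec.snd)
        (primrec_two_pow.comp (Primrec.fst.comp (Primrec.fst.comp Primrec.fst)))))
  exact (((sig1_nodup.comp Primrec.snd).and (hb.and hc)).ex).ex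

theorem computableSeq_of_sig1 {Z : ℕ → Bool}
    (h : Sig1 fun q : ℕ × Bool => Z q.1 = q.2) : ComputableSeq Z := by
  classical
  obtain ⟨R, hR, hp⟩ := h
  have hs : ∀ n, ∃ s, R (n, true) s ∨ R (n, false) s := by
    intro n
    cases hz : Z n with
    | true => exact ((hp (n, true)).1 hz).imp fun s => Or.inl
    | false => exact ((hp (n, false)).1 hz).imp fun s => Or.inr
  have hT : PrimrecRel fun (n s : ℕ) => R (n, true) s :=
    hR.comp (Primrec.pair Primrec.fst (Primrec.const true)) Primrec.snd
  have hF : PrimrecRel fun (n s : ℕ) => R (n, false) s :=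
    hR.comp (Primrec.pair Primrec.fst (Primrec.const false)) Primrec.snd
  have h1 : Primrec₂ fun n s => decide (R (n, true) s ∨ R (n, false) s) :=
    PrimrecPred.decide (PrimrecPred.or hT hF)
  have h2 := Partrec.rfind (p := fun n s =>
    Part.some (decide (R (n, true) s ∨ R (n, false) s))) h1.to_comp.partrec₂
  have h3 : Primrec₂ fun n s => cond (decide (R (n, true) s)) 1 0 :=
    Primrec.cond (PrimrecPred.decide hT) (Primrec.const 1) (Primrec.const 0)
  have h4 := Partrec.map h2 h3.to_comp
  obtain ⟨c, hc⟩ := exists_code (Partrec.nat_iff.1 h4)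
  refine ⟨c, ?_⟩
  rw [hc]
  funext n
  unfold chi
  rw [Part.eq_some_iff, Part.mem_map_iff]
  have hd : (Nat.rfind fun s => Part.some (decide (R (n, true) s ∨ R (n, false) s))).Dom := by
    refine Nat.rfind_dom'.2 ?_
    obtain ⟨s, hs⟩ := hs n
    exact ⟨s, by simpa using hs, by simp⟩
  refine ⟨_, Part.get_mem hd, ?_⟩
  have hsp := Nat.rfind_spec (Part.get_mem hd)
  generalize (Nat.rfind fun s => Part.some (decide (R (n, true) s ∨ R (n, false) s))).get hd = s
    at hsp
  have hsp : R (n, true) s ∨ R (n, false) s := by simpa using hsp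
  cases hz : Z n with
  | true =>
    have : ¬ R (n, false) s := fun h => by
      have := (hp (n, false)).2 ⟨s, h⟩
      simp [hz] at this
    simp [hsp.resolve_right this]
  | false =>
    have : ¬ R (n, true) s := fun h => by
      have := (hp (n, true)).2 ⟨s, h⟩
      simp [hz] at this
    simp [this]

theorem sig1_of_computableSeq {Z : ℕ → Bool} (h : ComputableSeq Z) :
    Sig1 fun q : ℕ × Bool => Z q.1 = q.2 := by
  obtain ⟨c, hc⟩ := h
  have h1 := (Sig1.of_partrec (partrec_empty c)).comp
    (f := fun q : ℕ × Bool => (q.1, cond q.2 1 0))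
    (Primrec.pair Primrec.fst (Primrec.cond Primrec.snd (Primrec.const 1) (Primrec.const 0)))
  refine h1.of_eq fun q => ?_
  rw [hc]
  unfold chi
  cases hz : Z q.1 <;> cases hq : q.2 <;> simp

theorem random_not_computable {A : ℕ → Bool} (hA : TwoRandom A) : ¬ ComputableSeq A := by
  intro h
  have h0 := sig1_of_computableSeq h
  have hs : Sig1 fun x : ℕ × List Bool => x.2 ∈ (fun i => ({pre A (i + 2)} : Set _)) x.1 := by
    have h1 : Sig1 fun y : ℕ × (ℕ × List Bool) => A y.1 = (y.2.2[y.1]?).getD false :=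
      h0.comp (Primrec.pair Primrec.fst (Primrec.option_getD.comp
        (Primrec.list_getElem?.comp (Primrec.snd.comp Primrec.snd) Primrec.fst)
        (Primrec.const false)))
    have h2 : Sig1 fun y : ℕ × List Bool =>
        ∀ j ∈ List.range (y.1 + 2), A j = (y.2[j]?).getD false :=
      h1.ball (Primrec.list_range.comp (Primrec.nat_add.comp Primrec.fst (Primrec.const 2)))
    have h3 : Sig1 fun y : ℕ × List Bool => y.2.length = y.1 + 2 :=
      Sig1.of_prim (Primrec.eq.comp (Primrec.list_length.comp Primrec.snd)
        (Primrec.nat_add.comp Primrec.fst (Primrec.const 2)))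
    refine (h3.and h2).of_eq fun y => ?_
    simp only [List.mem_range, Set.mem_singleton_iff]
    constructor
    · rintro ⟨e1, e2⟩
      rw [← e1, ← extendsStr_iff]
      intro i
      rw [e2 i.1 (by omega)]
      simp
    · intro e
      have e1 : y.2.length = y.1 + 2 := by rw [e]; simp
      refine ⟨e1, fun j hj => ?_⟩
      have : extendsStr A y.2 := by rw [extendsStr_iff, e1, e]
      have := this ⟨j, by omega⟩
      rw [show A j = _ from this]
      simp [e1, hj]
  obtain ⟨i, hi⟩ := hA (fun i => {pre A (i + 2)}) ⟨Sig2.uniformCEIn (Sig2.of_sig1 hs),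
    fun i => stringMeasure_singleton _ _ (length_pre _ _)⟩
  exact hi ⟨_, rfl, extendsStr_pre _ _⟩

theorem generic_not_computable {B : ℕ → Bool} (hB : TwoGeneric B) : ¬ ComputableSeq B := by
  intro h
  have h0 := sig1_of_computableSeq h
  have hW : Sig1 fun σ : List Bool => σ ∈ {σ : List Bool | ¬ extendsStr B σ} := by
    have h1 : Sig1 fun y : List Bool × (ℕ × Bool) => y.1[y.2.1]? = some y.2.2 ∧ B y.2.1 = !y.2.2 :=
      (Sig1.of_prim (Primrec.eq.comp
        (Primrec.list_getElem?.comp Primrec.fst (Primrec.fst.comp Primrec.snd))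
        (Primrec.option_some.comp (Primrec.snd.comp Primrec.snd)))).and
      (h0.comp (Primrec.pair (Primrec.fst.comp Primrec.snd)
        (Primrec.not.comp (Primrec.snd.comp Primrec.snd))))
    refine h1.ex.of_eq fun σ => ?_
    simp only [Set.mem_ofPred_eq, extendsStr, not_forall]
    constructor
    · rintro ⟨⟨i, b⟩, e1, e2⟩
      dsimp only at e1 e2
      obtain ⟨hi, e1⟩ := List.getElem?_eq_some_iff.1 e1
      refine ⟨⟨i, hi⟩, ?_⟩
      simp [e1, e2]
    · rintro ⟨i, hi⟩
      refine ⟨(i.1, σ.get i), by simp, ?_⟩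
      dsimp only
      revert hi
      cases B i.1 <;> cases σ.get i <;> simp
  obtain ⟨σ, h1, h2⟩ := hB _ (Sig2.ceIn (Sig2.of_sig1 hW))
  rcases h2 with h2 | h2
  · exact h2 h1
  · refine h2 (σ ++ [!B σ.length]) ⟨_, rfl⟩ fun h => ?_
    have := h ⟨σ.length, by simp⟩
    simp at this

theorem extendsStr.prefix_of_le {B : ℕ → Bool} {σ τ : List Bool} (h1 : extendsStr B σ)
    (h2 : extendsStr B τ) (h : σ.length ≤ τ.length) : σ <+: τ := by
  rw [extendsStr_iff.1 h1, extendsStr_iff.1 h2]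
  exact pre_mono _ h

theorem nonsplit_computable {B Z : ℕ → Bool} {c : OracleCode} {σ : List Bool}
    (hc : c.eval (chi B) = chi Z) (hσ : extendsStr B σ)
    (hs : ¬ ∃ τ₀ τ₁ : List Bool, ∃ x v₀ v₁ : ℕ, σ <+: τ₀ ∧ σ <+: τ₁ ∧
      v₀ ∈ c.eval (strOracle τ₀) x ∧ v₁ ∈ c.eval (strOracle τ₁) x ∧ v₀ ≠ v₁) :
    ComputableSeq Z := by
  apply computableSeq_of_sig1
  have h1 : Sig1 fun y : (ℕ × Bool) × List Bool =>
      σ <+: y.2 ∧ cond y.1.2 1 0 ∈ c.eval (strOracle y.2) y.1.1 :=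
    (sig1_isPre.comp (Primrec.pair (Primrec.const σ) Primrec.snd)).and
    ((sig1_eval c).comp (Primrec.pair (Primrec.pair Primrec.snd (Primrec.fst.comp Primrec.fst))
      (Primrec.cond (Primrec.snd.comp Primrec.fst) (Primrec.const 1) (Primrec.const 0))))
  refine h1.ex.of_eq fun q => ?_
  have key : ∃ τ, σ <+: τ ∧ cond (Z q.1) 1 0 ∈ c.eval (strOracle τ) q.1 := by
    have : cond (Z q.1) 1 0 ∈ c.eval (chi B) q.1 := by rw [hc]; exact Part.mem_some _
    obtain ⟨m, hm⟩ := eval_use c _ _ this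
    refine ⟨pre B (max m σ.length), ?_, eval_str_mono (pre_mono _ (le_max_left _ _)) hm⟩
    exact hσ.prefix_of_le (extendsStr_pre _ _) (by simp)
  obtain ⟨τ, k1, k2⟩ := key
  constructor
  · rintro ⟨τ', e1, e2⟩
    by_contra hne
    refine hs ⟨τ, τ', q.1, _, _, k1, e1, k2, e2, ?_⟩
    revert hne
    cases Z q.1 <;> cases q.2 <;> simp
  · intro h
    rw [h] at k2
    exact ⟨τ, k1, k2⟩

theorem sig2_nonsplit (c : OracleCode) : Sig2 fun σ : List Bool =>
    σ ∈ {σ : List Bool | ¬ ∃ τ₀ τ₁ : List Bool, ∃ x v₀ v₁ : ℕ, σ <+: τ₀ ∧ σ <+: τ₁ ∧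
      v₀ ∈ c.eval (strOracle τ₀) x ∧ v₁ ∈ c.eval (strOracle τ₁) x ∧ v₀ ≠ v₁} := by
  have h : Sig1 fun y : ((((List Bool × List Bool) × List Bool) × ℕ) × ℕ) × ℕ =>
      y.1.1.1.1.1 <+: y.1.1.1.1.2 ∧ y.1.1.1.1.1 <+: y.1.1.1.2 ∧
      y.1.2 ∈ c.eval (strOracle y.1.1.1.1.2) y.1.1.2 ∧
      y.2 ∈ c.eval (strOracle y.1.1.1.2) y.1.1.2 ∧ y.1.2 ≠ y.2 := by
    have p1 : Primrec fun y : ((((List Bool × List Bool) × List Bool) × ℕ) × ℕ) × ℕ => y.1.1.1 :=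
      Primrec.fst.comp (Primrec.fst.comp Primrec.fst)
    have p2 : Primrec fun y : ((((List Bool × List Bool) × List Bool) × ℕ) × ℕ) × ℕ => y.1.1.2 :=
      Primrec.snd.comp (Primrec.fst.comp Primrec.fst)
    have q1 := Primrec.fst.comp (Primrec.fst.comp p1)
    have q2 := Primrec.snd.comp (Primrec.fst.comp p1)
    have q3 := Primrec.snd.comp p1
    refine (sig1_isPre.comp (Primrec.pair q1 q2)).and
      ((sig1_isPre.comp (Primrec.pair q1 q3)).and
      (((sig1_eval c).comp (Primrec.pair (Primrec.pair q2 p2) (Primrec.snd.comp Primrec.fst))).and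
      (((sig1_eval c).comp (Primrec.pair (Primrec.pair q3 p2) Primrec.snd)).and
      (Sig1.of_prim (PrimrecPred.not (Primrec.eq.comp (Primrec.snd.comp Primrec.fst)
        Primrec.snd))))))
  exact Sig2.of_co h.ex.ex.ex.ex.ex

theorem sat_of_total {A : ℕ → Bool} {c : OracleCode} {ρ : List (ℕ × ℕ)}
    (h : ∀ p ∈ ρ, p.2 ∈ c.eval (chi A) p.1) : ∃ m, Sat c (pre A m) ρ := by
  induction ρ with
  | nil => exact ⟨0, by simp [Sat]⟩
  | cons p ρ ih =>
    obtain ⟨m, hm⟩ := ih fun q hq => h q (by simp [hq])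
    obtain ⟨m', hm'⟩ := eval_use c _ _ (h p (by simp))
    refine ⟨max m m', fun q hq => ?_⟩
    rcases List.mem_cons.1 hq with rfl | hq
    · exact eval_str_mono (pre_mono _ (le_max_right _ _)) hm'
    · exact eval_str_mono (pre_mono _ (le_max_left _ _)) (hm q hq)

/-- The string with code `e`. -/
def strOf (e : ℕ) : List Bool := (Encodable.decode (α := List Bool) e).getD []

theorem sig2_good (cA cB : OracleCode) :
    Sig2 fun x : (ℕ × ℕ) × (List Bool × List (ℕ × ℕ)) =>
      strOf x.1.2 <+: x.2.1 ∧ Sat cB x.2.1 x.2.2 ∧ ¬ Thick cA (x.1.2 + x.1.1 + 2) x.2.2 := by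
  have p1 : Primrec fun x : (ℕ × ℕ) × (List Bool × List (ℕ × ℕ)) => strOf x.1.2 :=
    Primrec.option_getD.comp (Primrec.decode.comp (Primrec.snd.comp Primrec.fst))
      (Primrec.const [])
  have p2 : Primrec fun x : (ℕ × ℕ) × (List Bool × List (ℕ × ℕ)) => x.1.2 + x.1.1 + 2 :=
    Primrec.nat_add.comp (Primrec.nat_add.comp (Primrec.snd.comp Primrec.fst)
      (Primrec.fst.comp Primrec.fst)) (Primrec.const 2)
  refine (Sig2.of_sig1 (sig1_isPre.comp (Primrec.pair p1 (Primrec.fst.comp Primrec.snd)))).and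
    ((Sig2.of_sig1 ((sig1_sat cB).comp Primrec.snd)).and (Sig2.of_co ?_))
  exact (sig1_thick cA).comp (Primrec.pair p2 (Primrec.snd.comp Primrec.snd))

theorem minimal_pair_aux {A B Z : ℕ → Bool} (hA : TwoRandom A) (hB : TwoGeneric B)
    (hZA : TRed Z A) (hZB : TRed Z B) : ComputableSeq Z := by
  obtain ⟨cA, hcA⟩ := hZA
  obtain ⟨cB, hcB⟩ := hZB
  obtain ⟨σ₀, hσ₀, hW⟩ := hB _ (Sig2.ceIn (sig2_nonsplit cB))
  rcases hW with hW | hW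
  · exact nonsplit_computable hcB hσ₀ hW
  exfalso
  have hdens := density (cA := cA) (cB := cB) (σ₀ := σ₀)
    (fun σ hσ => not_not.1 (hW σ hσ))
  obtain ⟨G, hG, hGp, hGu, hGe⟩ := (sig2_good cA cB).uniformize
  let V : ℕ → Set (List Bool) := fun k =>
    {ξ | ∃ y : ℕ × (List Bool × List (ℕ × ℕ)), G ((k, y.1), y.2) ∧ Sat cA ξ y.2.2}
  have hV : UniformCEIn zeroJump V := by
    apply Sig2.uniformCEIn
    have h1 : Sig2 fun z : (ℕ × List Bool) × (ℕ × (List Bool × List (ℕ × ℕ))) =>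
        G ((z.1.1, z.2.1), z.2.2) ∧ Sat cA z.1.2 z.2.2.2 :=
      (hG.comp (Primrec.pair (Primrec.pair (Primrec.fst.comp Primrec.fst)
        (Primrec.fst.comp Primrec.snd)) (Primrec.snd.comp Primrec.snd))).and
      (Sig2.of_sig1 ((sig1_sat cA).comp (Primrec.pair (Primrec.snd.comp Primrec.fst)
        (Primrec.snd.comp (Primrec.snd.comp Primrec.snd)))))
    exact h1.ex
  have hVm : ∀ k, stringMeasure (V k) < (2 : ℝ≥0∞)⁻¹ ^ k := by
    intro k
    refine stringMeasure_le _ (fun e => {η | ∃ b, G ((k, e), b) ∧ Sat cA η b.2}) k ?_ ?_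
    · rintro ξ ⟨⟨e, b⟩, h1, h2⟩ η hη
      exact ⟨e, b, h1, h2.mono hη⟩
    · intro e n L hL hL2
      rcases L.eq_nil_or_concat with rfl | ⟨L', ξ, hc⟩
      · simp
      obtain ⟨-, b, h1, -⟩ := hL2 ξ (by simp [hc])
      by_contra hlt
      refine (hGp _ _ h1).2.2 ⟨n, L, hL, fun η hη => ?_, not_le.1 hlt⟩
      obtain ⟨h3, b', h4, h5⟩ := hL2 η hη
      rw [hGu _ _ _ h1 h4]
      exact ⟨h3, h5⟩
  obtain ⟨k, hk⟩ := hA V ⟨hV, hVm⟩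
  have hD : Sig2 fun τ : List Bool =>
      τ ∈ {τ : List Bool | ∃ y : ℕ × List (ℕ × ℕ), G ((k, y.1), (τ, y.2))} := by
    have h1 : Sig2 fun z : List Bool × (ℕ × List (ℕ × ℕ)) => G ((k, z.2.1), (z.1, z.2.2)) :=
      hG.comp (Primrec.pair (Primrec.pair (Primrec.const k) (Primrec.fst.comp Primrec.snd))
        (Primrec.pair Primrec.fst (Primrec.snd.comp Primrec.snd)))
    exact h1.ex
  obtain ⟨σ₁, hσ₁, h⟩ := hB _ hD.ceIn
  rcases h with ⟨⟨e, ρ⟩, hy⟩ | h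
  · have hsat := (hGp _ _ hy).2.1
    dsimp only at hsat
    have h1 : ∀ p ∈ ρ, p.2 ∈ cA.eval (chi A) p.1 := by
      intro p hp
      rw [hcA, ← hcB]
      have := hsat p hp
      rw [extendsStr_iff.1 hσ₁] at this
      exact eval_chi_of_str this
    obtain ⟨m, hm⟩ := sat_of_total h1
    exact hk ⟨pre A m, ⟨(e, (σ₁, ρ)), hy, hm⟩, extendsStr_pre _ _⟩
  · let σ := pre B (max σ₀.length σ₁.length)
    have h0 : σ₀ <+: σ := hσ₀.prefix_of_le (extendsStr_pre _ _) (by simp [σ])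
    have h1 : σ₁ <+: σ := hσ₁.prefix_of_le (extendsStr_pre _ _) (by simp [σ])
    obtain ⟨τ, ρ, e1, e2, e3⟩ := hdens (Encodable.encode σ + k + 2) σ h0
    have hst : strOf (Encodable.encode σ) = σ := by simp [strOf]
    obtain ⟨b, hb⟩ := hGe (k, Encodable.encode σ) (τ, ρ) ⟨by rw [hst]; exact e1, e2, e3⟩
    refine h b.1 (h1.trans ?_) ⟨(Encodable.encode σ, b.2), hb⟩
    have := (hGp _ _ hb).1
    rwa [hst] at this

/-- every 2-random Turing degree forms a minimal pair with every
2-generic Turing degree. -/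
theorem twoRandom_twoGeneric_minimal_pair (A B : ℕ → Bool)
    (hA : TwoRandom A) (hB : TwoGeneric B) :
    ¬ ComputableSeq A ∧ ¬ ComputableSeq B ∧
      ∀ Z : ℕ → Bool, TRed Z A → TRed Z B → ComputableSeq Z := by

  exact ⟨random_not_computable hA, generic_not_computable hB,
    fun Z h1 h2 => minimal_pair_aux hA hB h1 h2⟩

end TypicalDegree
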